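/- arXiv:1912.10100 — 7 statements merged into one kernel-verified Lean document; each statement's English description precedes it below -/
import Mathlib

section
/- Let P₁ and P₂ be orthogonal projections on ℂ^d of the same rank m ≥ 1 whose ranges are isoclinic, i.e. there is a real λ with P₁ P₂ P₁ = λ·P₁ and P₂ P₁ P₂ = λ·P₂. Then each subspace range(P_k), k ∈ {1,2}, satisfies the Knill–Laflamme error correction conditions for the error operators E_i = (1/√2)·P_i, i ∈ {1,2}: for all i, j, k ∈ {1,2} there exists a scalar c ∈ ℂ such that P_k E_iᴴ E_j P_k = c·P_k (equivalently, P_k P_i P_j P_k is a scalar multiple of P_k). -/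
open Matrix

/-- If `P 0, P 1` are rank-`m` orthogonal projections on `ℂ^d`
(`m ≥ 1`) whose ranges are isoclinic (`P_i P_j P_i = λ • P_i` for a real `λ`),
then each range of `P k` satisfies the Knill–Laflamme conditions for the error
operators `E i = (1/√2) • P i`: every `P k E_iᴴ E_j P k` is a scalar multiple
of `P k`. -/
theorem stmt_8 {d m : ℕ} (hm : 1 ≤ m)
    (P : Fin 2 → Matrix (Fin d) (Fin d) ℂ)
    (hP : ∀ i, (P i)ᴴ = P i ∧ P i * P i = P i)
    (hrank : ∀ i, (P i).rank = m)
    (lam : ℝ)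
    (h01 : P 0 * P 1 * P 0 = (lam : ℂ) • P 0)
    (h10 : P 1 * P 0 * P 1 = (lam : ℂ) • P 1)
    (E : Fin 2 → Matrix (Fin d) (Fin d) ℂ)
    (hE : ∀ i, E i = ((Real.sqrt 2 : ℂ))⁻¹ • P i) :
    ∀ i j k : Fin 2, ∃ c : ℂ, P k * (E i)ᴴ * E j * P k = c • P k := by
  have S : ∀ i k : Fin 2, ∃ c : ℂ, P k * P i * P k = c • P k := by
    intro i k
    have h0 := (hP 0).2
    have h1 := (hP 1).2
    fin_cases i <;> fin_cases k
    · exact ⟨1, by simp [h0]⟩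
    · exact ⟨_, h10⟩
    · exact ⟨_, h01⟩
    · exact ⟨1, by simp [h1]⟩
  have T : ∀ i j k : Fin 2, ∃ c : ℂ, P k * P i * P j * P k = c • P k := by
    intro i j k
    have hc : i = k ∨ j = k ∨ i = j := by omega
    rcases hc with h | h | h
    · subst h
      obtain ⟨c, hc⟩ := S j i
      exact ⟨c, by rw [(hP i).2, hc]⟩
    · subst h
      obtain ⟨c, hc⟩ := S i j
      exact ⟨c, by rw [mul_assoc _ (P j) (P j), (hP j).2, hc]⟩
    · subst h
      obtain ⟨c, hc⟩ := S i k
      exact ⟨c, by rw [mul_assoc (P k), (hP i).2, hc]⟩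
  intro i j k
  obtain ⟨c, hc⟩ := T i j k
  refine ⟨(Real.sqrt 2 : ℂ)⁻¹ * (star ((Real.sqrt 2 : ℂ)⁻¹) * c), ?_⟩
  rw [hE i, hE j, conjTranspose_smul, (hP i).1]
  simp only [Matrix.mul_smul, Matrix.smul_mul, hc, smul_smul]
  rw [mul_assoc]
end

section
/- Let P and Q be orthogonal projections on ℂ^n of the same rank k ≥ 1, and let c be a nonzero real number. Then P Q P = c·P if and only if Q P Q = c·Q. (In particular, for the ranges of P and Q to be isoclinic at angle θ with cos θ = c ≠ 0, either one of the two identities suffices.) -/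
open Matrix

theorem stmt_9_aux {n : ℕ}
    (P Q : Matrix (Fin n) (Fin n) ℂ)
    (hr : P.rank = Q.rank)
    (c : ℂ) (hc : c ≠ 0) (h : P * Q * P = c • P) : Q * P * Q = c • Q := by
  have h1 : P = (c⁻¹ • P) * (Q * P) := by
    rw [Matrix.smul_mul, ← Matrix.mul_assoc, h, smul_smul, inv_mul_cancel₀ hc, one_smul]
  have h2 : Q.rank ≤ (Q * P).rank := by
    rw [← hr]
    calc P.rank = ((c⁻¹ • P) * (Q * P)).rank := congrArg _ h1
      _ ≤ _ := Matrix.rank_mul_le_right _ _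
  have h3 : LinearMap.range (Q * P).mulVecLin ≤ LinearMap.range Q.mulVecLin := by
    rw [Matrix.mulVecLin_mul]
    exact LinearMap.range_comp_le_range _ _
  have h4 := Submodule.eq_of_le_of_finrank_le h3 h2
  apply Matrix.ext_of_mulVec_single
  intro i
  have h5 : Q *ᵥ Pi.single i 1 ∈ LinearMap.range (Q * P).mulVecLin := by
    rw [h4]; exact ⟨_, rfl⟩
  obtain ⟨w, hw⟩ := h5
  rw [Matrix.mulVecLin_apply] at hw
  rw [← Matrix.mulVec_mulVec, Matrix.smul_mulVec, ← hw, Matrix.mulVec_mulVec,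
    ← Matrix.smul_mulVec]
  congr 1
  rw [Matrix.mul_assoc, ← Matrix.mul_assoc P, h, Matrix.mul_smul]

/-- For orthogonal projections `P, Q` on `ℂ^n` of the same rank
`k ≥ 1` and a nonzero real scalar `c`, we have `P Q P = c • P` iff
`Q P Q = c • Q`. -/
theorem stmt_9 {n k : ℕ} (hk : 1 ≤ k)
    (P Q : Matrix (Fin n) (Fin n) ℂ)
    (hP : Pᴴ = P) (hP2 : P * P = P) (hQ : Qᴴ = Q) (hQ2 : Q * Q = Q)
    (hrP : P.rank = k) (hrQ : Q.rank = k)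
    (c : ℝ) (hc : c ≠ 0) :
    P * Q * P = (c : ℂ) • P ↔ Q * P * Q = (c : ℂ) • Q := by
  have hc' : (c : ℂ) ≠ 0 := by exact_mod_cast hc
  exact ⟨stmt_9_aux P Q (hrP.trans hrQ.symm) c hc', stmt_9_aux Q P (hrQ.trans hrP.symm) c hc'⟩
end

section
/- Let P be a nonzero orthogonal projection on ℂ^d, let ι be a finite index set, let E : ι → M_d(ℂ) be a family of matrices, and let α : ι → ι → ℂ be scalars such that P E_iᴴ E_j P = α_{ij}·P for all i, j ∈ ι. Then the ι×ι matrix (α_{ij}) is positive semidefinite. -/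
open Matrix
open scoped ComplexOrder

/-- If `P` is a nonzero orthogonal projection on `ℂ^d` and the
Knill–Laflamme conditions `P E_iᴴ E_j P = α_{ij} • P` hold, then the matrix
`(α_{ij})` is positive semidefinite. -/
theorem stmt_11 {d : ℕ} {ι : Type*} [Fintype ι] [DecidableEq ι]
    (P : Matrix (Fin d) (Fin d) ℂ) (hP : Pᴴ = P) (hP2 : P * P = P) (hPne : P ≠ 0)
    (E : ι → Matrix (Fin d) (Fin d) ℂ) (α : ι → ι → ℂ)
    (hKL : ∀ i j, P * (E i)ᴴ * E j * P = α i j • P) :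
    (Matrix.of fun i j => α i j).PosSemidef := by
  have hPP : Pᴴ * P = P := by rw [hP, hP2]
  have hpsd : P.PosSemidef := hPP ▸ Matrix.posSemidef_conjTranspose_mul_self P
  have hk : ∃ k, P k k ≠ 0 := by
    by_contra! h
    apply hPne
    rw [← Matrix.trace_conjTranspose_mul_self_eq_zero_iff, hPP]
    simp [Matrix.trace, h]
  obtain ⟨k, hk⟩ := hk
  have hk0 : 0 ≤ P k k := hpsd.diag_nonneg
  have hinv : 0 ≤ (P k k)⁻¹ := inv_nonneg.mpr hk0
  let B : Matrix (Fin d) ι ℂ := Matrix.of fun a i => (E i * P) a k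
  have key : (Matrix.of fun i j => α i j) = (P k k)⁻¹ • (Bᴴ * B) := by
    ext i j
    have h1 : (Bᴴ * B) i j = ((E i * P)ᴴ * (E j * P)) k k := by
      simp only [Matrix.mul_apply (M := Bᴴ), Matrix.mul_apply (M := (E i * P)ᴴ),
        Matrix.conjTranspose_apply, B, Matrix.of_apply]
    have h2 : (E i * P)ᴴ * (E j * P) = α i j • P := by
      rw [← hKL, Matrix.conjTranspose_mul, hP]
      simp only [Matrix.mul_assoc]
    rw [Matrix.smul_apply, h1, h2, Matrix.smul_apply, Matrix.of_apply, smul_eq_mul, smul_eq_mul]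
    field_simp
  rw [key]
  exact (Matrix.posSemidef_conjTranspose_mul_self B).smul hinv
end

section
/- Let P be an orthogonal projection on ℂ^d, let ι be a finite index set, let E : ι → M_d(ℂ) and α : ι → ι → ℂ satisfy P E_iᴴ E_j P = α_{ij}·P for all i, j ∈ ι. Let u be a unitary ι×ι complex matrix and define new error operators F_j := Σ_{i∈ι} u_{ij}·E_i for each j ∈ ι. Then P F_iᴴ F_j P = α'_{ij}·P for all i, j, where α' = uᴴ α u. In particular the Knill–Laflamme conditions are preserved under unitary recombination of the error operators, with coefficient matrix conjugated by u. -/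
open Matrix

/-- The Knill–Laflamme conditions are preserved under unitary
recombination of the error operators: if `P E_iᴴ E_j P = α_{ij} • P` and `u`
is unitary, then the operators `F_j = Σ_i u_{ij} • E_i` satisfy
`P F_iᴴ F_j P = (uᴴ α u)_{ij} • P`. -/
theorem stmt_12 {d : ℕ} {ι : Type*} [Fintype ι] [DecidableEq ι]
    (P : Matrix (Fin d) (Fin d) ℂ) (hP : Pᴴ = P) (hP2 : P * P = P)
    (E : ι → Matrix (Fin d) (Fin d) ℂ) (α : Matrix ι ι ℂ)
    (hKL : ∀ i j, P * (E i)ᴴ * E j * P = α i j • P)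
    (u : Matrix ι ι ℂ) (hu : uᴴ * u = 1 ∧ u * uᴴ = 1)
    (F : ι → Matrix (Fin d) (Fin d) ℂ)
    (hF : ∀ j, F j = ∑ i, u i j • E i) :
    ∀ i j, P * (F i)ᴴ * F j * P = (uᴴ * α * u) i j • P := by
  intro i j
  rw [hF i, hF j, Matrix.conjTranspose_sum]
  simp only [Matrix.conjTranspose_smul, Matrix.mul_sum, Matrix.sum_mul, Matrix.mul_smul,
    Matrix.smul_mul, hKL, Matrix.mul_apply, Matrix.conjTranspose_apply, Finset.sum_smul,
    Finset.sum_mul, smul_smul]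
  rw [Finset.sum_comm]
  refine Finset.sum_congr rfl fun k _ => Finset.sum_congr rfl fun l _ => ?_
  congr 1
  ring
end

section
/- Let M be an n×n complex matrix and set N := I_n + Mᴴ M. Then N is invertible, and the 2n×2n block matrix P_M := [[N⁻¹, N⁻¹ Mᴴ], [M N⁻¹, M N⁻¹ Mᴴ]] is an orthogonal projection (P_Mᴴ = P_M and P_M² = P_M) whose range, as a linear map on ℂ^n ⊕ ℂ^n, equals the graph of M, i.e. the subspace {(x, M x) : x ∈ ℂ^n}. -/
open Matrix

open scoped ComplexOrder in
theorem aux_unit {n : ℕ} (M : Matrix (Fin n) (Fin n) ℂ) :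
    IsUnit (1 + Mᴴ * M) ∧ (1 + Mᴴ * M).IsHermitian := by
  have hpd : (1 + Mᴴ * M).PosDef :=
    Matrix.PosDef.one.add_posSemidef (Matrix.posSemidef_conjTranspose_mul_self M)
  exact ⟨hpd.isUnit, hpd.isHermitian⟩

/-- For an `n × n` complex matrix `M`, the matrix
`N = I + Mᴴ M` is invertible and the block matrix
`P_M = [[N⁻¹, N⁻¹ Mᴴ], [M N⁻¹, M N⁻¹ Mᴴ]]` is an orthogonal projection whose
range equals the graph `{(x, M x) : x ∈ ℂ^n}` of `M`. -/
theorem stmt_13 {n : ℕ} (M : Matrix (Fin n) (Fin n) ℂ) :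
    IsUnit (1 + Mᴴ * M) ∧
    (let N : Matrix (Fin n) (Fin n) ℂ := 1 + Mᴴ * M
     let PM : Matrix (Fin n ⊕ Fin n) (Fin n ⊕ Fin n) ℂ :=
       Matrix.fromBlocks N⁻¹ (N⁻¹ * Mᴴ) (M * N⁻¹) (M * N⁻¹ * Mᴴ)
     PMᴴ = PM ∧ PM * PM = PM ∧
     ∀ v : Fin n ⊕ Fin n → ℂ,
       v ∈ LinearMap.range PM.mulVecLin ↔
         ∃ x : Fin n → ℂ, v = Sum.elim x (M.mulVec x)) := by
  have hU : IsUnit (1 + Mᴴ * M) := (aux_unit M).1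
  refine ⟨hU, ?_⟩
  intro N PM
  have hH : (N⁻¹)ᴴ = N⁻¹ := (aux_unit M).2.inv
  have hK : N⁻¹ + N⁻¹ * Mᴴ * M = 1 := by
    have h := Matrix.nonsing_inv_mul N ((Matrix.isUnit_iff_isUnit_det _).1 hU)
    rw [← h]
    simp only [N, mul_add, mul_one, mul_assoc]
  have key : ∀ X : Matrix (Fin n) (Fin n) ℂ, N⁻¹ * X + N⁻¹ * (Mᴴ * (M * X)) = X := by
    intro X
    have h := congrArg (· * X) hK
    simpa only [add_mul, one_mul, mul_assoc] using h
  refine ⟨?_, ?_, ?_⟩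
  · simp only [PM, Matrix.fromBlocks_conjTranspose, Matrix.conjTranspose_mul,
      Matrix.conjTranspose_conjTranspose, hH, mul_assoc]
  · simp only [PM, Matrix.fromBlocks_multiply, mul_assoc, ← mul_add, key]
  · intro v
    constructor
    · rintro ⟨w, rfl⟩
      refine ⟨N⁻¹ *ᵥ (w ∘ Sum.inl) + (N⁻¹ * Mᴴ) *ᵥ (w ∘ Sum.inr), ?_⟩
      rw [Matrix.mulVecLin_apply, Matrix.fromBlocks_mulVec]
      simp only [Matrix.mulVec_add, Matrix.mulVec_mulVec, mul_assoc]
    · rintro ⟨x, rfl⟩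
      refine ⟨Sum.elim x (M *ᵥ x), ?_⟩
      have h1 : N⁻¹ *ᵥ x + (N⁻¹ * Mᴴ) *ᵥ (M *ᵥ x) = x := by
        rw [Matrix.mulVec_mulVec, ← Matrix.add_mulVec, hK, Matrix.one_mulVec]
      have h2 : (M * N⁻¹) *ᵥ x + (M * N⁻¹ * Mᴴ) *ᵥ (M *ᵥ x) = M *ᵥ x := by
        rw [mul_assoc M, ← Matrix.mulVec_mulVec, ← Matrix.mulVec_mulVec (M *ᵥ x) M,
          ← Matrix.mulVec_add, h1]
      rw [Matrix.mulVecLin_apply, Matrix.fromBlocks_mulVec]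
      simp only [Sum.elim_comp_inl, Sum.elim_comp_inr, h1, h2]
end

section
/- Let A and B be n×n complex matrices and let λ ∈ ℂ. Suppose (I_n + Aᴴ B)(I_n + Bᴴ B)⁻¹(I_n + Bᴴ A) = λ·(I_n + Aᴴ A). Then the orthogonal projections P_A and P_B onto the graphs of A and B, given in block form by P_M = [[N_M⁻¹, N_M⁻¹ Mᴴ], [M N_M⁻¹, M N_M⁻¹ Mᴴ]] with N_M = I_n + Mᴴ M, satisfy P_A P_B P_A = λ·P_A. -/
open Matrix

/-- If `(I + Aᴴ B)(I + Bᴴ B)⁻¹(I + Bᴴ A) = λ • (I + Aᴴ A)`,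
then the orthogonal projections `P_A`, `P_B` onto the graphs of `A` and `B`
satisfy `P_A P_B P_A = λ • P_A`. -/
theorem stmt_14 {n : ℕ} (A B : Matrix (Fin n) (Fin n) ℂ) (lam : ℂ)
    (h : (1 + Aᴴ * B) * (1 + Bᴴ * B)⁻¹ * (1 + Bᴴ * A) = lam • (1 + Aᴴ * A)) :
    let NA : Matrix (Fin n) (Fin n) ℂ := 1 + Aᴴ * A
    let NB : Matrix (Fin n) (Fin n) ℂ := 1 + Bᴴ * B
    let PA : Matrix (Fin n ⊕ Fin n) (Fin n ⊕ Fin n) ℂ :=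
      Matrix.fromBlocks NA⁻¹ (NA⁻¹ * Aᴴ) (A * NA⁻¹) (A * NA⁻¹ * Aᴴ)
    let PB : Matrix (Fin n ⊕ Fin n) (Fin n ⊕ Fin n) ℂ :=
      Matrix.fromBlocks NB⁻¹ (NB⁻¹ * Bᴴ) (B * NB⁻¹) (B * NB⁻¹ * Bᴴ)
    PA * PB * PA = lam • PA := by
  intro NA NB PA PB
  have key : ∀ M X : Matrix (Fin n) (Fin n) ℂ,
      Matrix.fromBlocks X (X * Mᴴ) (M * X) (M * X * Mᴴ)
        = fromRows (1 : Matrix (Fin n) (Fin n) ℂ) M * X * fromCols (1 : Matrix (Fin n) (Fin n) ℂ) Mᴴ := by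
    intro M X
    rw [fromRows_mul, fromRows_mul_fromCols]
    simp
  have cr : ∀ M K : Matrix (Fin n) (Fin n) ℂ,
      fromCols (1 : Matrix (Fin n) (Fin n) ℂ) Mᴴ * fromRows (1 : Matrix (Fin n) (Fin n) ℂ) K = 1 + Mᴴ * K := by
    intro M K
    rw [fromCols_mul_fromRows]
    simp
  have hinv : NA⁻¹ * NA * NA⁻¹ = NA⁻¹ := by
    by_cases hu : IsUnit NA.det
    · rw [nonsing_inv_mul _ hu, one_mul]
    · simp [nonsing_inv_apply_not_isUnit _ hu]
  have hA : PA = fromRows (1 : Matrix (Fin n) (Fin n) ℂ) A * NA⁻¹ * fromCols (1 : Matrix (Fin n) (Fin n) ℂ) Aᴴ := key A _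
  have hB : PB = fromRows (1 : Matrix (Fin n) (Fin n) ℂ) B * NB⁻¹ * fromCols (1 : Matrix (Fin n) (Fin n) ℂ) Bᴴ := key B _
  calc PA * PB * PA
      = fromRows (1 : Matrix (Fin n) (Fin n) ℂ) A * (NA⁻¹ * ((fromCols (1 : Matrix (Fin n) (Fin n) ℂ) Aᴴ * fromRows (1 : Matrix (Fin n) (Fin n) ℂ) B) * NB⁻¹
          * (fromCols (1 : Matrix (Fin n) (Fin n) ℂ) Bᴴ * fromRows (1 : Matrix (Fin n) (Fin n) ℂ) A)) * NA⁻¹) * fromCols (1 : Matrix (Fin n) (Fin n) ℂ) Aᴴ := by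
        rw [hA, hB]; simp only [Matrix.mul_assoc]
    _ = fromRows (1 : Matrix (Fin n) (Fin n) ℂ) A * (lam • (NA⁻¹ * NA * NA⁻¹)) * fromCols (1 : Matrix (Fin n) (Fin n) ℂ) Aᴴ := by
        rw [cr, cr, h, Matrix.mul_smul, Matrix.smul_mul]
    _ = lam • PA := by
        rw [hinv, hA, Matrix.mul_smul, Matrix.smul_mul]
end

section
/- Let P be an orthogonal projection on ℂ^n of rank l with 0 < l < n, and let k be a positive integer with k ≤ min(l, n − l). Then the rank-k numerical range of P is the full interval [0,1]: for every real λ with 0 ≤ λ ≤ 1 there exists a rank-k orthogonal projection R on ℂ^n such that R P R = λ·R. -/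
open Matrix

theorem aux_iso {n k : ℕ} (P : Matrix (Fin n) (Fin n) ℂ) (hP2 : P * P = P)
    (hk : k ≤ P.rank) : ∃ V : Matrix (Fin n) (Fin k) ℂ, Vᴴ * V = 1 ∧ P * V = V := by
  let S := LinearMap.range (Matrix.toEuclideanLin P)
  have hS : P.rank = Module.finrank ℂ S := by
    exact Matrix.rank_eq_finrank_range_toLin P (EuclideanSpace.basisFun (Fin n) ℂ).toBasis
      (EuclideanSpace.basisFun (Fin n) ℂ).toBasis
  let b := stdOrthonormalBasis ℂ S
  let f : Fin k → EuclideanSpace ℂ (Fin n) := fun j => (b (Fin.castLE (hS ▸ hk) j) : S)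
  refine ⟨Matrix.of fun i j => f j i, ?_, ?_⟩
  · ext i j
    have h := orthonormal_iff_ite.1 b.orthonormal (Fin.castLE (hS ▸ hk) i) (Fin.castLE (hS ▸ hk) j)
    rw [Submodule.coe_inner, PiLp.inner_apply] at h
    simp only [Fin.castLE_inj] at h
    rw [Matrix.one_apply, ← h]
    simp [Matrix.mul_apply, f, mul_comm]
  · ext i j
    obtain ⟨y, hy⟩ := (b (Fin.castLE (hS ▸ hk) j)).2
    have hf : f j = Matrix.toEuclideanLin P y := hy.symm
    have h2 : P *ᵥ (f j).ofLp = (f j).ofLp := by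
      rw [hf]
      simp [Matrix.toLpLin_apply, hP2]
    have := congrFun h2 i
    simpa [Matrix.mul_apply, Matrix.mulVec, dotProduct] using this

/-- If `P` is an orthogonal projection on `ℂ^n` of rank `l` with
`0 < l < n`, and `k` is a positive integer with `k ≤ min l (n - l)`, then the
rank-`k` numerical range of `P` is all of `[0, 1]`: for every `λ ∈ [0, 1]`
there is a rank-`k` orthogonal projection `R` with `R P R = λ • R`. -/
theorem stmt_15 {n l k : ℕ} (P : Matrix (Fin n) (Fin n) ℂ)
    (hP : Pᴴ = P) (hP2 : P * P = P)
    (hrank : P.rank = l) (hl0 : 0 < l) (hln : l < n)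
    (hk0 : 0 < k) (hk : k ≤ min l (n - l)) :
    ∀ lam : ℝ, 0 ≤ lam → lam ≤ 1 →
      ∃ R : Matrix (Fin n) (Fin n) ℂ,
        Rᴴ = R ∧ R * R = R ∧ R.rank = k ∧ R * P * R = (lam : ℂ) • R := by
  intro lam h0 h1
  have hr : n ≤ P.rank + (1 - P).rank := by
    have h := LinearMap.finrank_range_add_finrank_ker P.mulVecLin
    have hle : LinearMap.ker P.mulVecLin ≤ LinearMap.range (1 - P).mulVecLin := by
      intro x hx
      have hx' : P *ᵥ x = 0 := by simpa using hx
      exact ⟨x, by simp [Matrix.sub_mulVec, hx']⟩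
    have h2 := Submodule.finrank_mono hle
    rw [Module.finrank_fin_fun] at h
    unfold Matrix.rank
    omega
  obtain ⟨V, hV, hPV⟩ := aux_iso (k := k) P hP2 (by omega)
  obtain ⟨W, hW, hPW'⟩ := aux_iso (k := k) (1 - P)
    (by simp [Matrix.sub_mul, Matrix.mul_sub, hP2]) (by omega)
  have hPW : P * W = 0 := by
    simpa [Matrix.sub_mul] using hPW'
  have hVP : Vᴴ * P = Vᴴ := by
    have := congrArg conjTranspose hPV
    simpa [hP] using this
  have hVW : Vᴴ * W = 0 := by
    rw [← hVP, Matrix.mul_assoc, hPW, Matrix.mul_zero]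
  have hWV : Wᴴ * V = 0 := by
    have := congrArg conjTranspose hVW
    simpa using this
  let a : ℂ := (Real.sqrt lam : ℝ)
  let c : ℂ := (Real.sqrt (1 - lam) : ℝ)
  have ha : a * a = lam := by
    simp only [a]; rw [← Complex.ofReal_mul, Real.mul_self_sqrt h0]
  have hc : c * c = 1 - lam := by
    simp only [c]; rw [← Complex.ofReal_mul, Real.mul_self_sqrt (by linarith)]; simp
  have hsa : star a = a := by simp [a]
  have hsc : star c = c := by simp [c]
  obtain ⟨X, hX⟩ : ∃ X, X = a • V + c • W := ⟨_, rfl⟩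
  have hXH : Xᴴ = a • Vᴴ + c • Wᴴ := by
    rw [hX, conjTranspose_add, conjTranspose_smul, conjTranspose_smul, hsa, hsc]
  have hXX : Xᴴ * X = 1 := by
    rw [hXH, hX]
    simp only [Matrix.add_mul, Matrix.mul_add, Matrix.smul_mul, Matrix.mul_smul, hV, hW, hVW, hWV,
      smul_smul, ha, hc, smul_zero, add_zero, zero_add]
    rw [← add_smul]; simp
  have hPX : P * X = a • V := by
    rw [hX]; simp [Matrix.mul_add, hPV, hPW]
  have hXPX : Xᴴ * (P * X) = (lam : ℂ) • 1 := by
    rw [hPX, hXH]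
    simp [Matrix.add_mul, hV, hWV, smul_smul, ha]
  refine ⟨X * Xᴴ, by simp, ?_, ?_, ?_⟩
  · rw [Matrix.mul_assoc, ← Matrix.mul_assoc Xᴴ, hXX, Matrix.one_mul]
  · open scoped ComplexOrder in
    rw [Matrix.rank_self_mul_conjTranspose, ← Matrix.rank_conjTranspose_mul_self, hXX]
    simp
  · calc X * Xᴴ * P * (X * Xᴴ) = X * (Xᴴ * (P * X)) * Xᴴ := by simp only [Matrix.mul_assoc]
      _ = _ := by rw [hXPX]; simp
end
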